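/- arXiv:1412.2561 — 2 statements merged into one kernel-verified Lean document; each statement's English description precedes it below -/
import Mathlib

section
/- Let G be a finite multigraph, t ≥ 1 an integer, and K a field of characteristic 0. Then Σ_{k≥0} dim_K(k-th graded component of B_G^{F_t}) · y^{t·e(G)−k} = (y·(y^t − 1)/(y − 1))^{v(G)−c(G)} · T_G((y^{t+1} − 1)/(y^{t+1} − y), y^t), as an identity of rational functions in y; equivalently, the dimension of the k-th graded component of B_G^{F_t} is the coefficient of y^{t·e(G)−k} in the polynomial on the right-hand side. -/
open MvPolynomial

namespace ForestAlg

variable {V E : Type*}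

/-- Two vertices are directly connected by an edge of `A`. -/
def edgeRel (ends : E → Sym2 V) (A : Finset E) (v w : V) : Prop :=
  ∃ e ∈ A, ends e = s(v, w)

/-- Number of connected components of the spanning subgraph `(V, A)`. -/
noncomputable def numComponents (ends : E → Sym2 V) (A : Finset E) : ℕ :=
  Nat.card (Quot (edgeRel ends A))

/-- Rank `r(A) = v(G) - c(V,A)`. -/
noncomputable def rank (ends : E → Sym2 V) (A : Finset E) : ℕ :=
  Nat.card V - numComponents ends A

/-- `A` is a subforest (contains no cycle): `|A| = v(G) - c(V,A)`. -/
def IsForest (ends : E → Sym2 V) (A : Finset E) : Prop :=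
  A.card + numComponents ends A = Nat.card V

/-- The Tutte polynomial, evaluated at `(x, y)`. -/
noncomputable def tutte [Fintype E] {R : Type*} [CommRing R]
    (ends : E → Sym2 V) (x y : R) : R :=
  ∑ A ∈ (Finset.univ : Finset E).powerset,
    (x - 1) ^ (rank ends Finset.univ - rank ends A) *
      (y - 1) ^ (A.card - rank ends A)

/-- `e ∉ F` is externally active for the subforest `F` with respect to the linear
order `o`: `F + e` contains a cycle and `e` is the minimal edge of that cycle
(the edges of the unique cycle of `F + e` are those whose removal does not
decrease the rank). -/
def ExtActive [DecidableEq E] (o : LinearOrder E) (ends : E → Sym2 V)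
    (F : Finset E) (e : E) : Prop :=
  e ∉ F ∧ ¬ IsForest ends (insert e F) ∧
    ∀ f ∈ insert e F,
      rank ends ((insert e F).erase f) = rank ends (insert e F) → o.le e f

/-- External activity `act_G(F)`. -/
noncomputable def act [DecidableEq E] (o : LinearOrder E) (ends : E → Sym2 V)
    (F : Finset E) : ℕ :=
  Set.ncard {e : E | ExtActive o ends F e}

/-- `D_I`: number of edges with one endpoint in `I` and the other outside `I`. -/
noncomputable def crossCount {n : ℕ} (ends : E → Sym2 (Fin n))
    (I : Finset (Fin n)) : ℕ :=
  Set.ncard {e : E | (∃ v ∈ ends e, v ∈ I) ∧ ∃ w ∈ ends e, w ∉ I}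

/-- The ideal `J_G^{F_t}` generated by `(∑_{i ∈ I} x_i)^{t·D_I + 1}` over nonempty `I`. -/
noncomputable def forestIdeal (K : Type*) [Field K] {n : ℕ} (t : ℕ)
    (ends : E → Sym2 (Fin n)) : Ideal (MvPolynomial (Fin n) K) :=
  Ideal.span {p | ∃ I : Finset (Fin n), I.Nonempty ∧
    p = (∑ i ∈ I, X i) ^ (t * crossCount ends I + 1)}

/-- The `k`-th graded component of `K[x_1,…,x_n]/J` (for homogeneous `J`):
the image of the degree-`k` homogeneous part in the quotient. -/
noncomputable def gradedPiece (K : Type*) [Field K] {n : ℕ}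
    (J : Ideal (MvPolynomial (Fin n) K)) (k : ℕ) :
    Submodule K (MvPolynomial (Fin n) K ⧸ J) :=
  Submodule.map (Ideal.Quotient.mkₐ K J).toLinearMap
    (homogeneousSubmodule (Fin n) K k)

/-- Dimension of the `k`-th graded component of the quotient. -/
noncomputable def gradedDim (K : Type*) [Field K] {n : ℕ}
    (J : Ideal (MvPolynomial (Fin n) K)) (k : ℕ) : ℕ :=
  Module.finrank K (gradedPiece K J k)


section InverseSystem

variable {K : Type*} [Field K]

/-- The directional derivative `∑_{i ∈ I} ∂/∂x_i`. -/
noncomputable def sumDeriv (K : Type*) [Field K] (I : Finset V) :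
    Derivation K (MvPolynomial V K) (MvPolynomial V K) :=
  ∑ i ∈ I, pderiv i

lemma sumDeriv_apply (I : Finset V) (f : MvPolynomial V K) :
    sumDeriv K I f = ∑ i ∈ I, pderiv i f := by
  simp only [sumDeriv]
  induction I using Finset.cons_induction with
  | empty => simp
  | cons i I hi ih => rw [Finset.sum_cons, Finset.sum_cons, Derivation.add_apply, ih]

/-- The forms of degree `k` killed by `(∑_{i ∈ I} ∂/∂x_i)^{d I + 1}` for every `I`. -/
noncomputable def inverseSystem (K : Type*) [Field K] (d : Finset V → ℕ) (k : ℕ) :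
    Submodule K (MvPolynomial V K) :=
  homogeneousSubmodule V K k ⊓
    ⨅ I : Finset V, LinearMap.ker (((sumDeriv K I).toLinearMap : Module.End K _) ^ (d I + 1))

lemma mem_inverseSystem {d : Finset V → ℕ} {k : ℕ} {f : MvPolynomial V K} :
    f ∈ inverseSystem K d k ↔ f.IsHomogeneous k ∧
      ∀ I, (((sumDeriv K I).toLinearMap : Module.End K _) ^ (d I + 1)) f = 0 := by
  simp [inverseSystem, Submodule.mem_iInf]

instance finite_homogeneousSubmodule [Finite V] (k : ℕ) :
    Module.Finite K (homogeneousSubmodule V K k) :=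
  Module.Finite.iff_fg.mpr (homogeneousSubmodule_fg V K k)

instance finite_inverseSystem [Finite V] (d : Finset V → ℕ) (k : ℕ) :
    Module.Finite K (inverseSystem K d k) :=
  Submodule.finiteDimensional_of_le (S₂ := homogeneousSubmodule V K k) inf_le_left

variable [Fintype V]

/-- The apolar pairing, for which the monomials are orthogonal and `⟨x^m, x^m⟩ = m!`. -/
noncomputable def apolar (V K : Type*) [Fintype V] [Field K] :
    MvPolynomial V K →ₗ[K] MvPolynomial V K →ₗ[K] K :=
  (basisMonomials V K).constr K
    (fun m => ((∏ i, (m i).factorial : ℕ) : K) • MvPolynomial.lcoeff K m)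

lemma apolar_monomial (m : V →₀ ℕ) (f : MvPolynomial V K) :
    apolar V K (monomial m 1) f = ((∏ i, (m i).factorial : ℕ) : K) * coeff m f := by
  have := (basisMonomials V K).constr_basis K
    (fun m => ((∏ i, (m i).factorial : ℕ) : K) • MvPolynomial.lcoeff K m) m
  rw [coe_basisMonomials] at this
  rw [apolar, this]
  simp

lemma apolar_monomial_right (m : V →₀ ℕ) (f : MvPolynomial V K) :
    apolar V K f (monomial m 1) = ((∏ i, (m i).factorial : ℕ) : K) * coeff m f := by
  classical
  have : (apolar V K).flip (monomial m 1)
      = ((∏ i, (m i).factorial : ℕ) : K) • MvPolynomial.lcoeff K m := by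
    refine (basisMonomials V K).ext fun n => ?_
    rw [coe_basisMonomials]
    simp only [LinearMap.flip_apply, apolar_monomial, LinearMap.smul_apply, lcoeff_apply,
      coeff_monomial, smul_eq_mul]
    by_cases h : m = n
    · simp [h]
    · simp [h, Ne.symm h]
  simpa using LinearMap.congr_fun this f

lemma apolar_X_mul (i : V) (p f : MvPolynomial V K) :
    apolar V K (X i * p) f = apolar V K p (pderiv i f) := by
  classical
  have : (apolar V K).flip f ∘ₗ LinearMap.mulLeft K (X i) = (apolar V K).flip (pderiv i f) := by
    refine (basisMonomials V K).ext fun m => ?_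
    rw [coe_basisMonomials]
    have hX : (X i * monomial m 1 : MvPolynomial V K) = monomial (m + Finsupp.single i 1) 1 := by
      rw [X, monomial_mul, one_mul, add_comm]
    simp only [LinearMap.comp_apply, LinearMap.mulLeft_apply, LinearMap.flip_apply, hX,
      apolar_monomial, coeff_pderiv]
    have hf : ∏ j, ((m + Finsupp.single i 1 : V →₀ ℕ) j).factorial
        = (m i + 1) * ∏ j, (m j).factorial := by
      rw [← Finset.mul_prod_erase _ _ (Finset.mem_univ i),
        ← Finset.mul_prod_erase _ (fun j => (m j).factorial) (Finset.mem_univ i)]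
      rw [Finset.prod_congr rfl (g := fun j => (m j).factorial)]
      · simp [Nat.factorial_succ, mul_assoc]
      · intro j hj
        simp [(Finset.ne_of_mem_erase hj).symm]
    rw [hf]
    push_cast
    ring
  simpa using LinearMap.congr_fun this p

lemma apolar_sum_X_pow_mul (I : Finset V) (m : ℕ) (p f : MvPolynomial V K) :
    apolar V K ((∑ i ∈ I, X i) ^ m * p) f
      = apolar V K p ((((sumDeriv K I).toLinearMap : Module.End K _) ^ m) f) := by
  induction m generalizing f with
  | zero => simp
  | succ m ih =>
    rw [pow_succ', mul_assoc, Finset.sum_mul, map_sum, LinearMap.sum_apply]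
    simp_rw [apolar_X_mul]
    rw [← map_sum, ← sumDeriv_apply, ih, pow_succ, Module.End.mul_apply]
    rfl

lemma coeff_eq_zero_of_apolar [CharZero K] {m : V →₀ ℕ} {f : MvPolynomial V K}
    (h : apolar V K (monomial m 1) f = 0) : coeff m f = 0 := by
  rw [apolar_monomial] at h
  refine (mul_eq_zero.mp h).resolve_left ?_
  exact_mod_cast Finset.prod_ne_zero_iff.mpr fun i _ => Nat.factorial_ne_zero _

lemma apolar_eq_zero_of_isHomogeneous {j k : ℕ} (hjk : j ≠ k) {p f : MvPolynomial V K}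
    (hp : p.IsHomogeneous j) (hf : f.IsHomogeneous k) : apolar V K p f = 0 := by
  classical
  conv_lhs => rw [p.as_sum]
  rw [map_sum, LinearMap.sum_apply]
  refine Finset.sum_eq_zero fun m hm => ?_
  have hdeg : m.degree = j := by
    by_contra h
    exact (mem_support_iff.mp hm) (hp.coeff_eq_zero h)
  rw [← mul_one (coeff m p), ← smul_eq_mul, ← smul_monomial, map_smul, LinearMap.smul_apply,
    apolar_monomial, hf.coeff_eq_zero (by omega)]
  simp

lemma finrank_gradedPiece [CharZero K] {n : ℕ} (d : Finset (Fin n) → ℕ) (k : ℕ) :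
    Module.finrank K (gradedPiece K (Ideal.span {p : MvPolynomial (Fin n) K |
      ∃ I : Finset (Fin n), I.Nonempty ∧ p = (∑ i ∈ I, X i) ^ (d I + 1)}) k)
      = Module.finrank K (inverseSystem K d k) := by
  classical
  set J := Ideal.span {p : MvPolynomial (Fin n) K |
      ∃ I : Finset (Fin n), I.Nonempty ∧ p = (∑ i ∈ I, X i) ^ (d I + 1)} with hJ
  set H := homogeneousSubmodule (Fin n) K k
  let B : LinearMap.BilinForm K H := LinearMap.BilinForm.restrict (apolar (Fin n) K) H
  let L : H →ₗ[K] MvPolynomial (Fin n) K ⧸ J := (Ideal.Quotient.mkₐ K J).toLinearMap ∘ₗ H.subtype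
  have hB : ∀ p f : H, B p f = apolar (Fin n) K p f := fun p f => rfl
  have hL : LinearMap.range L = gradedPiece K J k := by
    rw [LinearMap.range_comp, Submodule.range_subtype]
    rfl
  have hker : ∀ p : H, p ∈ LinearMap.ker L ↔ (p : MvPolynomial (Fin n) K) ∈ J := fun p => by
    simp [L, Ideal.Quotient.eq_zero_iff_mem]
  have hmon : ∀ m : Fin n →₀ ℕ, m.degree = k → (monomial m (1 : K)) ∈ H := fun m hm =>
    isHomogeneous_monomial 1 hm
  have hnd : B.Nondegenerate := by
    constructor
    · intro p hp
      ext m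
      by_cases hm : m.degree = k
      · have := hp ⟨_, hmon m hm⟩
        rw [hB, apolar_monomial_right, ← apolar_monomial] at this
        simpa using coeff_eq_zero_of_apolar this
      · simpa using IsHomogeneous.coeff_eq_zero p.2 hm
    · intro p hp
      ext m
      by_cases hm : m.degree = k
      · simpa using coeff_eq_zero_of_apolar (hp ⟨_, hmon m hm⟩)
      · simpa using IsHomogeneous.coeff_eq_zero p.2 hm
  have horth : (B.orthogonal (LinearMap.ker L)).map H.subtype = inverseSystem K d k := by
    ext f
    rw [mem_inverseSystem, Submodule.mem_map]
    constructor
    · rintro ⟨f, hf, rfl⟩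
      refine ⟨f.2, fun I => ?_⟩
      rcases I.eq_empty_or_nonempty with rfl | hI
      · have : (sumDeriv K (∅ : Finset (Fin n))).toLinearMap = 0 := by
          ext; simp [sumDeriv]
        rw [this]
        simp
      ext m
      rw [coeff_zero]
      apply coeff_eq_zero_of_apolar
      rw [← apolar_sum_X_pow_mul]
      have hhom : ((∑ i ∈ I, X i) ^ (d I + 1) * monomial m (1 : K)).IsHomogeneous
          (1 * (d I + 1) + m.degree) :=
        ((IsHomogeneous.sum _ _ _ fun i _ => isHomogeneous_X K i).pow _).mul
          (isHomogeneous_monomial 1 rfl)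
      by_cases hdeg : 1 * (d I + 1) + m.degree = k
      · rw [hdeg] at hhom
        refine hf ⟨_, hhom⟩ ((hker _).mpr ?_)
        exact Ideal.mul_mem_right _ _ (Ideal.subset_span ⟨I, hI, rfl⟩)
      · exact apolar_eq_zero_of_isHomogeneous hdeg hhom f.2
    · rintro ⟨hf, hd⟩
      refine ⟨⟨f, hf⟩, fun p hp => ?_, rfl⟩
      have key : ∀ p ∈ J, ∀ q, apolar (Fin n) K (p * q) f = 0 := by
        intro p hp
        induction hp using Submodule.span_induction with
        | mem p hp =>
          obtain ⟨I, -, rfl⟩ := hp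
          intro q
          rw [apolar_sum_X_pow_mul, hd, map_zero]
        | zero => simp
        | add p₁ p₂ _ _ h₁ h₂ => intro q; rw [add_mul, map_add, LinearMap.add_apply, h₁, h₂, add_zero]
        | smul r p _ h => intro q; rw [smul_eq_mul, mul_comm r, mul_assoc, h]
      have h := key p ((hker p).mp hp) 1
      rwa [mul_one] at h
  have h₁ := L.finrank_range_add_finrank_ker
  have h₂ := LinearMap.BilinForm.finrank_orthogonal hnd (LinearMap.ker L)
  rw [hL] at h₁
  rw [← horth, Submodule.finrank_map_subtype_eq]
  omega

end InverseSystem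

section Edges

variable {K : Type*} [Field K]

/-- The number of edges of `S` (with endpoints `a e`, `b e`) leaving `I`. -/
def crossing [DecidableEq V] (a b : E → V) (S : Finset E) (I : Finset V) : ℕ :=
  (S.filter fun e => ¬ (a e ∈ I ↔ b e ∈ I)).card

/-- The span of the products `∏_{e ∈ A} (x_{a e} - x_{b e})` over `A ⊆ S` with `k` elements. -/
noncomputable def edgeSpan (K : Type*) [Field K] (a b : E → V) (S : Finset E) (k : ℕ) :
    Submodule K (MvPolynomial V K) :=
  Submodule.span K ((fun A : Finset E => ∏ e ∈ A, (X (a e) - X (b e))) '' (S.powersetCard k : Set _))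

lemma prod_mem_edgeSpan {a b : E → V} {S A : Finset E} (h : A ⊆ S) :
    ∏ e ∈ A, (X (a e) - X (b e)) ∈ edgeSpan K a b S A.card :=
  Submodule.subset_span ⟨A, by simp [h], rfl⟩

instance finite_edgeSpan (a b : E → V) (S : Finset E) (k : ℕ) :
    Module.Finite K (edgeSpan K a b S k) :=
  FiniteDimensional.span_of_finite K ((Finset.finite_toSet _).image _)

lemma edgeSpan_le_iff {a b : E → V} {S : Finset E} {k : ℕ} {M : Submodule K (MvPolynomial V K)} :
    edgeSpan K a b S k ≤ M ↔
      ∀ A ⊆ S, A.card = k → ∏ e ∈ A, (X (a e) - X (b e)) ∈ M := by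
  rw [edgeSpan, Submodule.span_le, Set.image_subset_iff]
  simp only [Set.subset_def, Finset.mem_powersetCard, Set.mem_preimage,
    SetLike.mem_coe, and_imp]

lemma sumDeriv_X_sub_X [DecidableEq V] (I : Finset V) (u v : V) :
    sumDeriv K I (X u - X v) = C ((if u ∈ I then 1 else 0) - if v ∈ I then 1 else 0) := by
  classical
  have h : ∀ w, sumDeriv K I (X w) = C (if w ∈ I then 1 else 0) := fun w => by
    rw [sumDeriv_apply]
    simp [pderiv_X, Pi.single_apply, apply_ite C]
  rw [map_sub, h, h, C_sub]

lemma derivation_pow_mul (D : Derivation K (MvPolynomial V K) (MvPolynomial V K))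
    {l : MvPolynomial V K} {c : K} (hl : D l = C c) (m : ℕ) (g : MvPolynomial V K) :
    ((D.toLinearMap : Module.End K _) ^ (m + 1)) (l * g)
      = l * ((D.toLinearMap : Module.End K _) ^ (m + 1)) g
        + (m + 1 : MvPolynomial V K) * C c * ((D.toLinearMap : Module.End K _) ^ m) g := by
  induction m with
  | zero => simp [hl]; ring
  | succ m ih =>
    rw [pow_succ', Module.End.mul_apply, ih, Module.End.mul_apply]
    simp only [pow_succ' _ m, Module.End.mul_apply]
    generalize ((D.toLinearMap : Module.End K _) ^ m) g = x
    have hm : D (m + 1 : MvPolynomial V K) = 0 := by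
      rw [← Nat.cast_succ]; exact D.map_natCast _
    have hc : D (C c) = 0 := D.map_algebraMap c
    simp [hl, hm, hc]
    ring

lemma derivation_pow_mul_of_eq_zero (D : Derivation K (MvPolynomial V K) (MvPolynomial V K))
    {l : MvPolynomial V K} (hl : D l = 0) (m : ℕ) (g : MvPolynomial V K) :
    ((D.toLinearMap : Module.End K _) ^ m) (l * g)
      = l * ((D.toLinearMap : Module.End K _) ^ m) g := by
  induction m with
  | zero => simp
  | succ m ih => simp [pow_succ', ih, hl]

lemma X_sub_X_ne_zero {u v : V} (h : u ≠ v) : (X u - X v : MvPolynomial V K) ≠ 0 :=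
  sub_ne_zero.mpr fun h' => h (X_injective h')

lemma isHomogeneous_X_sub_X (u v : V) : (X u - X v : MvPolynomial V K).IsHomogeneous 1 :=
  (isHomogeneous_X K u).sub (isHomogeneous_X K v)

lemma not_isUnit_X_sub_X (u v : V) : ¬ IsUnit (X u - X v : MvPolynomial V K) := fun h => by
  have := h.map (aeval (fun _ => (0 : K)) : MvPolynomial V K →ₐ[K] K)
  simp at this

lemma sumDeriv_pow_prod_eq_zero [DecidableEq V] (a b : E → V) (I : Finset V) (A : Finset E) {m : ℕ}
    (hm : crossing a b A I < m) :
    (((sumDeriv K I).toLinearMap : Module.End K _) ^ m) (∏ e ∈ A, (X (a e) - X (b e))) = 0 := by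
  classical
  induction A using Finset.induction_on generalizing m with
  | empty =>
    obtain ⟨m, rfl⟩ := Nat.exists_eq_succ_of_ne_zero (Nat.ne_zero_of_lt hm)
    simp [pow_succ]
  | insert e A he ih =>
    rw [Finset.prod_insert he]
    obtain ⟨m, rfl⟩ := Nat.exists_eq_succ_of_ne_zero (Nat.ne_zero_of_lt hm)
    rw [crossing, Finset.filter_insert] at hm
    by_cases h : a e ∈ I ↔ b e ∈ I
    · rw [if_neg (not_not.mpr h)] at hm
      rw [derivation_pow_mul_of_eq_zero, ih hm, mul_zero]
      rw [sumDeriv_X_sub_X]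
      simp [h]
    · rw [if_pos h, Finset.card_insert_of_notMem (by simp [he])] at hm
      rw [Nat.succ_eq_add_one, derivation_pow_mul _ (sumDeriv_X_sub_X I _ _), ih, ih]
      · simp
      · rw [crossing]; omega
      · rw [crossing]; omega

lemma crossing_mono [DecidableEq V] (a b : E → V) {A S : Finset E} (h : A ⊆ S) (I : Finset V) :
    crossing a b A I ≤ crossing a b S I :=
  Finset.card_le_card (Finset.filter_subset_filter _ h)

lemma edgeSpan_le_inverseSystem [DecidableEq V] (a b : E → V) (S : Finset E) (k : ℕ) :
    edgeSpan K a b S k ≤ inverseSystem K (crossing a b S) k := by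
  rw [edgeSpan_le_iff]
  rintro A hA rfl
  refine mem_inverseSystem.mpr ⟨?_, fun I => ?_⟩
  · have := IsHomogeneous.prod A (fun e => (X (a e) - X (b e) : MvPolynomial V K)) (fun _ => 1)
      fun e _ => isHomogeneous_X_sub_X _ _
    simpa using this
  · exact sumDeriv_pow_prod_eq_zero a b I A
      (Nat.lt_succ_of_le (crossing_mono a b hA I))

lemma eq_zero_of_mul_derivation_add [CharZero K] [Finite V]
    (D : Derivation K (MvPolynomial V K) (MvPolynomial V K)) {l u : MvPolynomial V K}
    (hl : ¬ IsUnit l) {c : K} (hc : c ≠ 0) (hD : D l = C c) (m : ℕ)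
    (h : l * D u + (m + 1 : MvPolynomial V K) * C c * u = 0) : u = 0 := by
  by_contra hu
  obtain ⟨w, hw, hlw⟩ := (FiniteMultiplicity.of_not_isUnit hl hu).exists_eq_pow_mul_and_not_dvd
  generalize multiplicity l u = j at hw
  have hl0 : l ≠ 0 := by
    rintro rfl
    rw [map_zero, eq_comm, C_eq_zero] at hD
    exact hc hD
  have hDj : l * D (l ^ j) = (j : MvPolynomial V K) * C c * l ^ j := by
    rw [D.leibniz_pow, hD]
    rcases j with _ | j
    · simp
    · simp only [smul_eq_mul, nsmul_eq_mul, Nat.add_sub_cancel]; ring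
  have key : l ^ j * (l * D w + C ((j + m + 1 : K) * c) * w) = 0 := by
    rw [hw, D.leibniz] at h
    simp only [smul_eq_mul] at h
    simp only [C_mul, C_add, C_1, map_natCast]
    linear_combination h - w * hDj
  have key' := (mul_eq_zero.mp key).resolve_left (pow_ne_zero _ hl0)
  refine hlw ?_
  have hne : (j + m + 1 : K) * c ≠ 0 := mul_ne_zero (by exact_mod_cast Nat.succ_ne_zero (j + m)) hc
  refine ⟨- C ((j + m + 1 : K) * c)⁻¹ * D w, ?_⟩
  have h1 : C ((j + m + 1 : K) * c) * C ((j + m + 1 : K) * c)⁻¹ = (1 : MvPolynomial V K) := by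
    rw [← C_mul, mul_inv_cancel₀ hne, C_1]
  linear_combination C ((j + m + 1 : K) * c)⁻¹ * key' - w * h1

lemma isHomogeneous_of_mul {l g : MvPolynomial V K} {k : ℕ} (hl0 : l ≠ 0)
    (hl : l.IsHomogeneous 1) (h : (l * g).IsHomogeneous (k + 1)) : g.IsHomogeneous k := by
  have hg : l * g = l * homogeneousComponent k g := by
    let _ : GradedAlgebra (homogeneousSubmodule V K) := gradedAlgebra
    have h1 := DirectSum.coe_decompose_mul_add_of_left_mem (homogeneousSubmodule V K)
      (i := 1) (j := k) (a := l) (b := g) hl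
    have h2 := decomposition.decompose'_apply (l * g) (1 + k)
    have h3 := decomposition.decompose'_apply g k
    rw [← h3]
    refine Eq.trans ?_ h1
    refine Eq.trans ?_ h2.symm
    rw [add_comm 1 k, homogeneousComponent_eq_self h]
  rw [mul_left_cancel₀ hl0 hg]
  exact homogeneousComponent_isHomogeneous k g

end Edges

section DeletionContraction

variable [DecidableEq V] {K : Type*} [Field K]

/-- The map sending `v` to `u` and fixing all other vertices. -/
def merge (u v w : V) : V := if w = v then u else w

lemma merge_left (u v : V) : merge u v u = u := by
  simp [merge]

lemma merge_right (u v : V) : merge u v v = u := by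
  simp [merge]

lemma merge_of_ne {u v w : V} (h : w ≠ v) : merge u v w = w := by
  simp [merge, h]

lemma merge_ne {u v : V} (h : u ≠ v) (w : V) : merge u v w ≠ v := by
  unfold merge
  split_ifs with hw
  exacts [h, hw]

lemma X_sub_X_dvd_of_rename_merge {u v : V} {f : MvPolynomial V K}
    (hf : rename (merge u v) f = 0) : (X u - X v : MvPolynomial V K) ∣ f := by
  rw [← Ideal.mem_span_singleton, ← Ideal.Quotient.eq_zero_iff_mem]
  set I := Ideal.span {(X u - X v : MvPolynomial V K)}
  have h : (Ideal.Quotient.mkₐ K I).comp (rename (merge u v)) = Ideal.Quotient.mkₐ K I := by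
    ext w
    by_cases hw : w = v
    · subst hw
      simp only [AlgHom.comp_apply, rename_X, merge_right]
      exact Ideal.Quotient.eq.mpr (Ideal.mem_span_singleton_self _)
    · simp [merge_of_ne hw]
  have := AlgHom.congr_fun h f
  rw [AlgHom.comp_apply, hf, map_zero] at this
  exact this.symm

lemma rename_merge_X_sub_X (u v : V) :
    rename (merge u v) (X u - X v : MvPolynomial V K) = 0 := by
  simp [merge_left, merge_right]

lemma sumDeriv_rename [Fintype V] (s : V → V) (I : Finset V) (f : MvPolynomial V K) :
    sumDeriv K I (rename s f) = rename s (sumDeriv K {w | s w ∈ I} f) := by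
  classical
  have hX : ∀ (J : Finset V) w, sumDeriv K J (X w) = C (if w ∈ J then 1 else 0) := fun J w => by
    rw [sumDeriv_apply]
    simp [pderiv_X, Pi.single_apply, apply_ite C]
  induction f using MvPolynomial.induction_on with
  | C c =>
    rw [rename_C]
    have h : ∀ J : Finset V, sumDeriv K J (C c) = 0 := fun J => (sumDeriv K J).map_algebraMap c
    rw [h, h, map_zero]
  | add p q hp hq => rw [map_add, map_add, map_add, map_add, hp, hq]
  | mul_X p w hp =>
    simp only [map_mul, rename_X, Derivation.leibniz, hp, hX, smul_eq_mul, map_add, rename_C,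
      Finset.mem_filter, Finset.mem_univ, true_and]

lemma sumDeriv_pow_rename [Fintype V] (s : V → V) (I : Finset V) (m : ℕ) (f : MvPolynomial V K) :
    (((sumDeriv K I).toLinearMap : Module.End K _) ^ m) (rename s f)
      = rename s ((((sumDeriv K {w | s w ∈ I}).toLinearMap : Module.End K _) ^ m) f) := by
  induction m with
  | zero => simp
  | succ m ih =>
    rw [pow_succ', Module.End.mul_apply, ih, pow_succ', Module.End.mul_apply]
    exact sumDeriv_rename s I _

variable {a b : E → V} {S : Finset E} {e : E}

lemma rename_mem_inverseSystem [Fintype V] [DecidableEq E] {k : ℕ} {f : MvPolynomial V K}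
    (hf : f ∈ inverseSystem K (crossing a b (insert e S)) k) :
    rename (merge (a e) (b e)) f ∈
      inverseSystem K (crossing (merge (a e) (b e) ∘ a) (merge (a e) (b e) ∘ b) S) k := by
  rw [mem_inverseSystem] at hf ⊢
  refine ⟨hf.1.rename_isHomogeneous, fun I => ?_⟩
  have h := hf.2 ({w | merge (a e) (b e) w ∈ I} : Finset V)
  rw [sumDeriv_pow_rename]
  suffices crossing (merge (a e) (b e) ∘ a) (merge (a e) (b e) ∘ b) S I
      = crossing a b (insert e S) ({w | merge (a e) (b e) w ∈ I} : Finset V) by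
    rw [this, h, map_zero]
  rw [crossing, crossing, Finset.filter_insert, if_neg (by simp [merge_left, merge_right])]
  simp

lemma mem_inverseSystem_of_mul [Fintype V] [DecidableEq E] [CharZero K] (he : e ∉ S)
    (hab : a e ≠ b e) {k : ℕ} {g : MvPolynomial V K}
    (hg : (X (a e) - X (b e)) * g ∈ inverseSystem K (crossing a b (insert e S)) (k + 1)) :
    g ∈ inverseSystem K (crossing a b S) k := by
  rw [mem_inverseSystem] at hg ⊢
  refine ⟨isHomogeneous_of_mul (X_sub_X_ne_zero hab) (isHomogeneous_X_sub_X _ _) hg.1,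
    fun I => ?_⟩
  have h := hg.2 I
  rw [crossing, Finset.filter_insert] at h
  by_cases hI : a e ∈ I ↔ b e ∈ I
  · rw [if_neg (not_not.mpr hI), derivation_pow_mul_of_eq_zero _
      (by rw [sumDeriv_X_sub_X]; simp [hI])] at h
    exact (mul_eq_zero.mp h).resolve_left (X_sub_X_ne_zero hab)
  · rw [if_pos hI, Finset.card_insert_of_notMem (by simp [he]),
      derivation_pow_mul _ (sumDeriv_X_sub_X I _ _), pow_succ', Module.End.mul_apply] at h
    refine eq_zero_of_mul_derivation_add (sumDeriv K I) (not_isUnit_X_sub_X (a e) (b e)) ?_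
      (sumDeriv_X_sub_X I _ _) _ h
    by_cases h1 : a e ∈ I <;> by_cases h2 : b e ∈ I <;> simp_all

lemma finrank_map_add_finrank_inf_ker {M M' : Type*} [AddCommGroup M] [Module K M]
    [AddCommGroup M'] [Module K M'] (f : M →ₗ[K] M') (P : Submodule K M) [Module.Finite K P] :
    Module.finrank K (P.map f) + Module.finrank K ↥(P ⊓ LinearMap.ker f) = Module.finrank K P := by
  have h := (f.domRestrict P).finrank_range_add_finrank_ker
  have h1 : LinearMap.range (f.domRestrict P) = P.map f := by
    rw [LinearMap.domRestrict, LinearMap.range_comp, Submodule.range_subtype]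
  have h2 : (LinearMap.ker (f.domRestrict P)).map P.subtype = P ⊓ LinearMap.ker f := by
    rw [LinearMap.domRestrict, LinearMap.ker_comp, Submodule.map_comap_subtype]
  rw [h1, ← Submodule.finrank_map_subtype_eq, h2] at h
  exact h

lemma finrank_le_of_exact {M M' : Type*} [AddCommGroup M] [Module K M] [AddCommGroup M']
    [Module K M'] (f : M →ₗ[K] M') (g : M →ₗ[K] M) {P L : Submodule K M} {N : Submodule K M'}
    [Module.Finite K P] [Module.Finite K L] [Module.Finite K N]
    (hN : P.map f ≤ N) (hL : P ⊓ LinearMap.ker f ≤ L.map g) :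
    Module.finrank K P ≤ Module.finrank K N + Module.finrank K L := by
  have h := finrank_map_add_finrank_inf_ker f P
  have h3 := Submodule.finrank_mono hN
  have h4 := Submodule.finrank_mono hL
  have h5 := Submodule.finrank_map_le g L
  omega

lemma le_finrank_of_exact {M M' : Type*} [AddCommGroup M] [Module K M] [AddCommGroup M']
    [Module K M'] (f : M →ₗ[K] M') (g : M →ₗ[K] M) (hg : Function.Injective g)
    {P L : Submodule K M} {N : Submodule K M'} [Module.Finite K P]
    (hN : N ≤ P.map f) (hL : L.map g ≤ P ⊓ LinearMap.ker f) :
    Module.finrank K N + Module.finrank K L ≤ Module.finrank K P := by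
  have h := finrank_map_add_finrank_inf_ker f P
  have : Module.Finite K ↥(P ⊓ LinearMap.ker f) :=
    Submodule.finiteDimensional_of_le (S₂ := P) inf_le_left
  have h3 := Submodule.finrank_mono hN
  have h4 := Submodule.finrank_mono hL
  have h5 := (Submodule.equivMapOfInjective g hg L).finrank_eq
  omega

lemma finrank_inverseSystem_insert_le [Fintype V] [DecidableEq E] [CharZero K] (he : e ∉ S)
    (hab : a e ≠ b e) (k : ℕ) :
    Module.finrank K (inverseSystem K (crossing a b (insert e S)) (k + 1))
      ≤ Module.finrank K (inverseSystem K
          (crossing (merge (a e) (b e) ∘ a) (merge (a e) (b e) ∘ b) S) (k + 1))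
        + Module.finrank K (inverseSystem K (crossing a b S) k) := by
  refine finrank_le_of_exact (rename (merge (a e) (b e))).toLinearMap
    (LinearMap.mulLeft K (X (a e) - X (b e))) ?_ ?_
  · rintro _ ⟨f, hf, rfl⟩
    exact rename_mem_inverseSystem hf
  · rintro f ⟨hf, hf0⟩
    obtain ⟨g, rfl⟩ := X_sub_X_dvd_of_rename_merge hf0
    exact ⟨g, mem_inverseSystem_of_mul he hab hf, rfl⟩

lemma le_finrank_edgeSpan_insert [DecidableEq E] (he : e ∉ S) (hab : a e ≠ b e) (k : ℕ) :
    Module.finrank K (edgeSpan K (merge (a e) (b e) ∘ a) (merge (a e) (b e) ∘ b) S (k + 1))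
        + Module.finrank K (edgeSpan K a b S k)
      ≤ Module.finrank K (edgeSpan K a b (insert e S) (k + 1)) := by
  refine le_finrank_of_exact (rename (merge (a e) (b e))).toLinearMap
    (LinearMap.mulLeft K (X (a e) - X (b e)))
    (mul_right_injective₀ (X_sub_X_ne_zero hab)) ?_ ?_
  · rw [edgeSpan_le_iff]
    rintro A hA hk
    refine ⟨∏ e ∈ A, (X (a e) - X (b e)),
      hk ▸ prod_mem_edgeSpan (hA.trans (Finset.subset_insert e S)), ?_⟩
    simp
  · rw [Submodule.map_le_iff_le_comap, edgeSpan_le_iff]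
    rintro A hA rfl
    have heA : e ∉ A := fun h => he (hA h)
    rw [Submodule.mem_comap, LinearMap.mulLeft_apply]
    refine ⟨?_, ?_⟩
    · rw [← Finset.prod_insert (f := fun e => (X (a e) - X (b e) : MvPolynomial V K)) heA,
        ← Finset.card_insert_of_notMem heA]
      exact prod_mem_edgeSpan (Finset.insert_subset_insert e hA)
    · rw [SetLike.mem_coe, LinearMap.mem_ker, AlgHom.toLinearMap_apply, map_mul,
        rename_merge_X_sub_X, zero_mul]

end DeletionContraction

section Components

lemma card_quot_congr {r r' : V → V → Prop} (h : ∀ x y, r x y → Quot.mk r' x = Quot.mk r' y)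
    (h' : ∀ x y, r' x y → Quot.mk r x = Quot.mk r y) : Nat.card (Quot r) = Nat.card (Quot r') :=
  Nat.card_congr
    { toFun := Quot.lift (Quot.mk r') h
      invFun := Quot.lift (Quot.mk r) h'
      left_inv := by rintro ⟨x⟩; rfl
      right_inv := by rintro ⟨x⟩; rfl }

lemma numComponents_le [Finite V] (ends : E → Sym2 V) (A : Finset E) :
    numComponents ends A ≤ Nat.card V :=
  Nat.card_le_card_of_surjective _ Quot.mk_surjective

lemma numComponents_anti [Finite V] (ends : E → Sym2 V) {A B : Finset E} (h : A ⊆ B) :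
    numComponents ends B ≤ numComponents ends A := by
  refine Nat.card_le_card_of_surjective (Quot.map id ?_) ?_
  · rintro x y ⟨e, he, hxy⟩
    exact ⟨e, h he, hxy⟩
  · rintro ⟨x⟩
    exact ⟨Quot.mk _ x, rfl⟩

lemma rank_mono [Finite V] (ends : E → Sym2 V) {A B : Finset E} (h : A ⊆ B) :
    rank ends A ≤ rank ends B :=
  Nat.sub_le_sub_left (numComponents_anti ends h) _

lemma rank_empty (ends : E → Sym2 V) : rank ends ∅ = 0 := by
  have h : numComponents ends ∅ = Nat.card V :=
    Nat.card_congr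
      { toFun := Quot.lift id (by rintro x y ⟨e, he, -⟩; simp at he)
        invFun := Quot.mk _
        left_inv := by rintro ⟨x⟩; rfl
        right_inv := fun x => rfl }
  rw [rank, h, Nat.sub_self]

variable [DecidableEq E]

lemma rank_insert_of_eq {a b : E → V} {e : E} (h : a e = b e) (A : Finset E) :
    rank (fun e => s(a e, b e)) (insert e A) = rank (fun e => s(a e, b e)) A := by
  rw [rank, rank, numComponents, numComponents]
  congr 1
  refine card_quot_congr ?_ ?_
  · rintro x y ⟨f, hf, hxy⟩
    rcases Finset.mem_insert.mp hf with rfl | hf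
    · rcases Sym2.eq_iff.mp hxy with ⟨rfl, rfl⟩ | ⟨rfl, rfl⟩ <;> rw [h]
    · exact Quot.sound ⟨f, hf, hxy⟩
  · rintro x y ⟨f, hf, hxy⟩
    exact Quot.sound ⟨f, Finset.mem_insert_of_mem hf, hxy⟩

lemma rank_insert_of_ne [DecidableEq V] [Finite V] {a b : E → V} {e : E} (h : a e ≠ b e)
    (A : Finset E) :
    rank (fun e => s(a e, b e)) (insert e A)
      = rank (fun f => s((merge (a e) (b e) ∘ a) f, (merge (a e) (b e) ∘ b) f)) A + 1 := by
  set ends : E → Sym2 V := fun e => s(a e, b e) with hends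
  set ends' : E → Sym2 V := fun f => s((merge (a e) (b e) ∘ a) f, (merge (a e) (b e) ∘ b) f)
    with hends'
  set π := merge (a e) (b e)
  let R := edgeRel ends (insert e A)
  let R' := edgeRel ends' A
  have hmap : ∀ f, ends' f = (ends f).map π := fun f => rfl
  have hπ : ∀ w, Quot.mk R (π w) = Quot.mk R w := fun w => by
    by_cases hw : w = b e
    · rw [hw]
      refine Quot.sound ⟨e, Finset.mem_insert_self e A, ?_⟩
      simp [π, merge_right, ends]
    · simp [π, merge_of_ne hw]
  have hne : ∀ w, π w ≠ b e := merge_ne h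
  have hsound : ∀ x y, R' x y → x ≠ b e ∧ y ≠ b e ∧ Quot.mk R x = Quot.mk R y := by
    rintro x y ⟨f, hf, hxy⟩
    have hR : Quot.mk R (a f) = Quot.mk R (b f) :=
      Quot.sound ⟨f, Finset.mem_insert_of_mem hf, rfl⟩
    rcases Sym2.eq_iff.mp hxy with ⟨rfl, rfl⟩ | ⟨rfl, rfl⟩
    · exact ⟨hne _, hne _, by simp only [Function.comp_apply]; rw [hπ, hπ, hR]⟩
    · exact ⟨hne _, hne _, by simp only [Function.comp_apply]; rw [hπ, hπ, hR]⟩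
  have hcard : Nat.card (Quot R') = Nat.card (Option (Quot R)) := Nat.card_congr
    { toFun := Quot.lift (fun w => if w = b e then none else some (Quot.mk R w)) (by
        intro x y hxy
        obtain ⟨hx, hy, hR⟩ := hsound x y hxy
        simp [hx, hy, hR])
      invFun := fun o => o.elim (Quot.mk R' (b e)) (Quot.lift (fun w => Quot.mk R' (π w)) (by
        rintro x y ⟨f, hf, hxy⟩
        rcases Finset.mem_insert.mp hf with rfl | hf
        · rcases Sym2.eq_iff.mp hxy with ⟨rfl, rfl⟩ | ⟨rfl, rfl⟩ <;>
            simp [π, merge_left, merge_right]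
        · refine Quot.sound ⟨f, hf, ?_⟩
          rw [hmap, hxy, Sym2.map_mk]))
      left_inv := by
        rintro ⟨w⟩
        by_cases hw : w = b e
        · simp [hw]
        · simp [hw, π, merge_of_ne hw]
      right_inv := by
        rintro (_ | ⟨⟨w⟩⟩)
        · simp
        · simp [hne, hπ] }
  rw [Finite.card_option] at hcard
  have h1 : numComponents ends' A = numComponents ends (insert e A) + 1 := hcard
  have h2 := numComponents_le ends' A
  rw [rank, rank]
  omega

lemma rank_le_card [DecidableEq V] [Finite V] (a b : E → V) (A : Finset E) :
    rank (fun e => s(a e, b e)) A ≤ A.card := by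
  induction A using Finset.induction_on generalizing a b with
  | empty => simp [rank_empty]
  | insert e A he ih =>
    rw [Finset.card_insert_of_notMem he]
    by_cases h : a e = b e
    · rw [rank_insert_of_eq h]
      exact (ih a b).trans (Nat.le_succ _)
    · rw [rank_insert_of_ne h]
      exact Nat.succ_le_succ (ih _ _)

end Components

section HilbertSeries

variable {K : Type*} [Field K]

lemma edgeSpan_zero (a b : E → V) (S : Finset E) :
    edgeSpan K a b S 0 = Submodule.span K {1} := by
  simp [edgeSpan]

lemma edgeSpan_eq_bot {a b : E → V} {S : Finset E} {k : ℕ} (h : S.card < k) :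
    edgeSpan K a b S k = ⊥ := by
  rw [edgeSpan, Finset.powersetCard_eq_empty.mpr h]
  simp

lemma finrank_edgeSpan_zero (a b : E → V) (S : Finset E) :
    Module.finrank K (edgeSpan K a b S 0) = 1 := by
  rw [edgeSpan_zero, finrank_span_singleton one_ne_zero]

lemma inverseSystem_zero_le (d : Finset V → ℕ) (a b : E → V) (S : Finset E) :
    inverseSystem K d 0 ≤ edgeSpan K a b S 0 := by
  refine inf_le_left.trans ?_
  rw [edgeSpan_zero, homogeneousSubmodule_zero, Submodule.one_eq_span]

lemma inverseSystem_crossing_empty [DecidableEq V] [Fintype V] [CharZero K] (a b : E → V) (k : ℕ) :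
    inverseSystem K (crossing a b ∅) (k + 1) = ⊥ := by
  rw [eq_bot_iff]
  intro f hf
  rw [mem_inverseSystem] at hf
  have h := hf.1.sum_X_mul_pderiv
  have h' : ∀ i, pderiv i f = 0 := fun i => by
    have := hf.2 {i}
    simpa [crossing, sumDeriv] using this
  simp only [h', mul_zero, Finset.sum_const_zero] at h
  exact (smul_eq_zero.mp h.symm).resolve_left (Nat.succ_ne_zero k)

lemma crossing_insert_of_eq [DecidableEq V] [DecidableEq E] {a b : E → V} {e : E}
    (h : a e = b e) (S : Finset E) : crossing a b (insert e S) = crossing a b S := by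
  funext I
  rw [crossing, Finset.filter_insert, if_neg (by simp [h]), crossing]

theorem inverseSystem_eq_edgeSpan_and_hilbert [DecidableEq V] [Fintype V] [DecidableEq E]
    [CharZero K] {F : Type*} [Field F] (y z : F) (hz : z * (y - 1) = y) (S : Finset E)
    (a b : E → V) :
    (∀ k, inverseSystem K (crossing a b S) k = edgeSpan K a b S k) ∧
    ∑ k ∈ Finset.range (S.card + 1),
        (Module.finrank K (edgeSpan K a b S k) : F) * y ^ (S.card - k)
      = ∑ A ∈ S.powerset, (y - 1) ^ A.card * z ^ rank (fun e => s(a e, b e)) A := by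
  induction S using Finset.induction_on generalizing a b with
  | empty =>
    refine ⟨fun k => ?_, by simp [finrank_edgeSpan_zero, rank_empty]⟩
    rcases k with _ | k
    · exact (inverseSystem_zero_le _ a b _).antisymm (edgeSpan_le_inverseSystem a b _ 0)
    · rw [inverseSystem_crossing_empty, edgeSpan_eq_bot (by simp)]
  | insert e S he ih =>
    rw [Finset.sum_powerset_insert he, Finset.card_insert_of_notMem he]
    have hcard : ∀ A ∈ S.powerset, (insert e A).card = A.card + 1 := fun A hA =>
      Finset.card_insert_of_notMem fun h => he (Finset.mem_powerset.mp hA h)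
    obtain ⟨ih₁, ih₂⟩ := ih a b
    by_cases hab : a e = b e
    · have hle : ∀ k, edgeSpan K a b S k ≤ edgeSpan K a b (insert e S) k := fun k =>
        edgeSpan_le_iff.mpr fun A hA hk => hk ▸ prod_mem_edgeSpan (hA.trans (by simp))
      have heq : ∀ k, edgeSpan K a b (insert e S) k = edgeSpan K a b S k := fun k =>
        ((edgeSpan_le_inverseSystem a b _ k).trans
          (by rw [crossing_insert_of_eq hab, ih₁])).antisymm (hle k)
      refine ⟨fun k => by rw [crossing_insert_of_eq hab, ih₁, heq], ?_⟩
      have hR : ∑ A ∈ S.powerset,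
          (y - 1) ^ (insert e A).card * z ^ rank (fun e => s(a e, b e)) (insert e A)
          = (y - 1) * ∑ A ∈ S.powerset, (y - 1) ^ A.card * z ^ rank (fun e => s(a e, b e)) A := by
        rw [Finset.mul_sum]
        refine Finset.sum_congr rfl fun A hA => ?_
        rw [hcard A hA, rank_insert_of_eq hab]
        ring
      rw [hR, ← ih₂, Finset.sum_range_succ, heq, edgeSpan_eq_bot (Nat.lt_succ_self _)]
      have hL : ∑ k ∈ Finset.range (S.card + 1),
          (Module.finrank K (edgeSpan K a b (insert e S) k) : F) * y ^ (S.card + 1 - k)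
          = y * ∑ k ∈ Finset.range (S.card + 1),
            (Module.finrank K (edgeSpan K a b S k) : F) * y ^ (S.card - k) := by
        rw [Finset.mul_sum]
        refine Finset.sum_congr rfl fun k hk => ?_
        rw [heq, Nat.sub_add_comm (Nat.lt_succ_iff.mp (Finset.mem_range.mp hk))]
        ring
      rw [hL]
      simp
      ring
    · obtain ⟨ih₃, ih₄⟩ := ih (merge (a e) (b e) ∘ a) (merge (a e) (b e) ∘ b)
      set a' := merge (a e) (b e) ∘ a
      set b' := merge (a e) (b e) ∘ b
      have hfin : ∀ k, inverseSystem K (crossing a b (insert e S)) (k + 1)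
            = edgeSpan K a b (insert e S) (k + 1) ∧
          Module.finrank K (edgeSpan K a b (insert e S) (k + 1))
            = Module.finrank K (edgeSpan K a' b' S (k + 1))
              + Module.finrank K (edgeSpan K a b S k) := fun k => by
        have h₁ := finrank_inverseSystem_insert_le (K := K) he hab k
        have h₂ := le_finrank_edgeSpan_insert (K := K) he hab k
        have h₃ := edgeSpan_le_inverseSystem (K := K) a b (insert e S) (k + 1)
        rw [ih₁, ih₃] at h₁
        have h₄ := Submodule.finrank_mono h₃
        exact ⟨(Submodule.eq_of_le_of_finrank_le h₃ (h₁.trans h₂)).symm,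
          le_antisymm (h₄.trans h₁) h₂⟩
      refine ⟨fun k => ?_, ?_⟩
      · rcases k with _ | k
        · exact (inverseSystem_zero_le _ a b _).antisymm (edgeSpan_le_inverseSystem a b _ 0)
        · exact (hfin k).1
      · have hR : ∑ A ∈ S.powerset,
            (y - 1) ^ (insert e A).card * z ^ rank (fun e => s(a e, b e)) (insert e A)
            = y * ∑ A ∈ S.powerset, (y - 1) ^ A.card * z ^ rank (fun e => s(a' e, b' e)) A := by
          rw [Finset.mul_sum]
          refine Finset.sum_congr rfl fun A hA => ?_
          rw [hcard A hA, rank_insert_of_ne hab]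
          linear_combination (y - 1) ^ A.card * z ^ rank (fun e => s(a' e, b' e)) A * hz
        have hL : y * ∑ k ∈ Finset.range (S.card + 1),
              (Module.finrank K (edgeSpan K a' b' S k) : F) * y ^ (S.card - k)
            = ∑ k ∈ Finset.range (S.card + 2),
              (Module.finrank K (edgeSpan K a' b' S k) : F) * y ^ (S.card + 1 - k) := by
          rw [Finset.sum_range_succ _ (S.card + 1), edgeSpan_eq_bot (Nat.lt_succ_self _),
            finrank_bot, Nat.cast_zero, zero_mul, add_zero, Finset.mul_sum]
          refine Finset.sum_congr rfl fun k hk => ?_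
          rw [Nat.sub_add_comm (Nat.lt_succ_iff.mp (Finset.mem_range.mp hk))]
          ring
        rw [hR, ← ih₂, ← ih₄, hL, Finset.sum_range_succ' _ (S.card + 1),
          Finset.sum_range_succ' _ (S.card + 1), finrank_edgeSpan_zero, finrank_edgeSpan_zero]
        simp only [(hfin _).2, Nat.cast_add, add_mul, Finset.sum_add_distrib,
          Nat.add_sub_add_right]
        ring

end HilbertSeries

section Thickening

lemma crossing_thicken {n : ℕ} [Fintype E] (a b : E → Fin n) (t : ℕ) (I : Finset (Fin n)) :
    crossing (fun e : E × Fin t => a e.1) (fun e : E × Fin t => b e.1) Finset.univ I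
      = t * crossCount (fun e => s(a e, b e)) I := by
  classical
  have h₁ : {e : E | (∃ v ∈ s(a e, b e), v ∈ I) ∧ ∃ w ∈ s(a e, b e), w ∉ I}
      = (Finset.univ.filter fun e => ¬ (a e ∈ I ↔ b e ∈ I) : Finset E) := by
    ext e
    simp only [Sym2.mem_iff, Set.mem_ofPred_eq, Finset.coe_filter, Finset.mem_univ, true_and,
      exists_eq_or_imp, exists_eq_left]
    tauto
  have h₂ : (Finset.univ.filter fun e : E × Fin t => ¬ (a e.1 ∈ I ↔ b e.1 ∈ I))
      = (Finset.univ.filter fun e => ¬ (a e ∈ I ↔ b e ∈ I)) ×ˢ Finset.univ := by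
    ext e
    simp
  rw [crossing, h₂, Finset.card_product, crossCount, h₁, Set.ncard_coe_finset]
  simp [mul_comm]

lemma rank_thicken [DecidableEq E] (ends : E → Sym2 V) {t : ℕ} (A : Finset (E × Fin t)) :
    rank (fun e => ends e.1) A = rank ends (A.image Prod.fst) := by
  have h : edgeRel (fun e : E × Fin t => ends e.1) A = edgeRel ends (A.image Prod.fst) := by
    ext v w
    simp [edgeRel]
  rw [rank, rank, numComponents, numComponents, h]

lemma sum_powerset_pow_card {F : Type*} [CommRing F] (w : F) (S : Finset E) :
    ∑ A ∈ S.powerset, w ^ A.card = (w + 1) ^ S.card := by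
  rw [← Finset.sum_pow_mul_eq_add_pow]
  simp

variable [Fintype E] [DecidableEq E] {F : Type*} [CommRing F]

lemma sum_filter_image_fst_eq (w : F) (t : ℕ) (S : Finset E) :
    ∑ A : Finset (E × Fin t) with A.image Prod.fst = S, w ^ A.card
      = ((w + 1) ^ t - 1) ^ S.card := by
  induction S using Finset.strongInduction with
  | H S ih =>
    have h₁ : ∑ B ∈ S.powerset, ∑ A : Finset (E × Fin t) with A.image Prod.fst = B, w ^ A.card
        = ∑ B ∈ S.powerset, ((w + 1) ^ t - 1) ^ B.card := by
      rw [sum_powerset_pow_card, sub_add_cancel, ← pow_mul]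
      have hmaps : ∀ A ∈ (S ×ˢ (Finset.univ : Finset (Fin t))).powerset,
          A.image Prod.fst ∈ S.powerset := fun A hA => by
        rw [Finset.mem_powerset] at hA ⊢
        exact Finset.image_subset_iff.mpr fun e he => (Finset.mem_product.mp (hA he)).1
      have hcard : t * S.card = (S ×ˢ (Finset.univ : Finset (Fin t))).card := by
        simp [mul_comm]
      rw [hcard, ← sum_powerset_pow_card, ← Finset.sum_fiberwise_of_maps_to hmaps]
      refine Finset.sum_congr rfl fun B hB => Finset.sum_congr ?_ fun _ _ => rfl
      ext A
      simp only [Finset.mem_filter, Finset.mem_univ, true_and, Finset.mem_powerset]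
      refine ⟨fun h => ⟨fun e he => ?_, h⟩, fun h => h.2⟩
      rw [Finset.mem_product]
      exact ⟨Finset.mem_powerset.mp hB (h ▸ Finset.mem_image_of_mem _ he), Finset.mem_univ _⟩
    have hS := Finset.mem_powerset_self S
    have hssub : ∀ B ∈ S.powerset.erase S, B ⊂ S := fun B hB =>
      (Finset.mem_powerset.mp (Finset.mem_of_mem_erase hB)).ssubset_of_ne
        (Finset.ne_of_mem_erase hB)
    rw [← Finset.add_sum_erase _ _ hS, ← Finset.add_sum_erase _ _ hS,
      Finset.sum_congr (s₁ := S.powerset.erase S) rfl fun B hB => ih B (hssub B hB)] at h₁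
    exact add_right_cancel h₁

lemma sum_thicken (w : F) (t : ℕ) (g : Finset E → F) :
    ∑ A : Finset (E × Fin t), w ^ A.card * g (A.image Prod.fst)
      = ∑ A : Finset E, ((w + 1) ^ t - 1) ^ A.card * g A := by
  rw [← Finset.sum_fiberwise Finset.univ fun A : Finset (E × Fin t) => A.image Prod.fst]
  refine Finset.sum_congr rfl fun S _ => ?_
  rw [← sum_filter_image_fst_eq, Finset.sum_mul]
  refine Finset.sum_congr rfl fun A hA => ?_
  rw [(Finset.mem_filter.mp hA).2]

end Thickening

lemma ratFunc_X_pow_sub_one_ne_zero (m : ℕ) (hm : 1 ≤ m) : (RatFunc.X : RatFunc ℚ) ^ m - 1 ≠ 0 := by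
  have h := (RatFunc.algebraMap_injective ℚ).ne
    (Polynomial.X_pow_sub_C_ne_zero (Nat.pos_of_ne_zero (Nat.one_le_iff_ne_zero.mp hm)) (1 : ℚ))
  simpa using h

/-- Let `G` be a finite multigraph on vertices `1,…,n`,
`t ≥ 1` and `K` a field of characteristic `0`. All graded components of
`B_G^{F_t}` of degree `> t·e(G)` vanish, and, as an identity of rational
functions in `y` (elements of `RatFunc ℚ` with `y = X`),
`Σ_{k≥0} dim_K (B_G^{F_t})_k · y^{t·e(G)-k}
  = (y·(y^t - 1)/(y - 1))^{v(G)-c(G)} · T_G((y^{t+1} - 1)/(y^{t+1} - y), y^t)`;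
equivalently, `dim_K (B_G^{F_t})_k` is the coefficient of `y^{t·e(G)-k}` in the
right-hand side. -/
theorem hilbert_B_Ft_eq_tutte {n : ℕ} {E : Type} [Fintype E]
    (ends : E → Sym2 (Fin n)) (t : ℕ) (ht : 1 ≤ t)
    (K : Type) [Field K] [CharZero K] :
    (∀ k : ℕ, t * Fintype.card E < k →
        gradedPiece K (forestIdeal K t ends) k = ⊥) ∧
    ∑ k ∈ Finset.range (t * Fintype.card E + 1),
        (gradedDim K (forestIdeal K t ends) k : RatFunc ℚ)
          * RatFunc.X ^ (t * Fintype.card E - k)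
      = (RatFunc.X * (RatFunc.X ^ t - 1) / (RatFunc.X - 1)) ^
          (n - numComponents ends Finset.univ)
        * tutte ends
            ((RatFunc.X ^ (t + 1) - 1) / (RatFunc.X ^ (t + 1) - RatFunc.X))
            ((RatFunc.X : RatFunc ℚ) ^ t) := by
  classical
  have hends : ∀ e, ∃ p : Fin n × Fin n, s(p.1, p.2) = ends e := fun e =>
    (ends e).ind fun x y => ⟨(x, y), rfl⟩
  choose p hp using hends
  obtain rfl : (fun e => s((p e).1, (p e).2)) = ends := funext hp
  set ends : E → Sym2 (Fin n) := fun e => s((p e).1, (p e).2)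
  let a : E × Fin t → Fin n := fun e => (p e.1).1
  let b : E × Fin t → Fin n := fun e => (p e.1).2
  have hcross : (fun I => t * crossCount ends I) = crossing a b Finset.univ :=
    funext fun I => (crossing_thicken (fun e => (p e).1) (fun e => (p e).2) t I).symm
  have hcard : (Finset.univ : Finset (E × Fin t)).card = t * Fintype.card E := by
    simp [mul_comm]
  set y : RatFunc ℚ := RatFunc.X
  have hy : y ≠ 0 := RatFunc.X_ne_zero
  have hpow : ∀ m : ℕ, 1 ≤ m → y ^ m - 1 ≠ 0 := ratFunc_X_pow_sub_one_ne_zero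
  have hy1 : y - 1 ≠ 0 := by simpa using hpow 1 le_rfl
  obtain ⟨hPQ, hsum⟩ := inverseSystem_eq_edgeSpan_and_hilbert (K := K) y (y / (y - 1))
    (div_mul_cancel₀ y hy1) Finset.univ a b
  have hdim : ∀ k, gradedDim K (forestIdeal K t ends) k
      = Module.finrank K (edgeSpan K a b Finset.univ k) := fun k => by
    rw [← hPQ, ← hcross]
    exact finrank_gradedPiece (fun I => t * crossCount ends I) k
  refine ⟨fun k hk => ?_, ?_⟩
  · have : Module.Finite K (gradedPiece K (forestIdeal K t ends) k) :=
      inferInstanceAs (Module.Finite K (Submodule.map _ _))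
    rw [← Submodule.finrank_eq_zero (R := K)]
    refine (hdim k).trans ?_
    rw [edgeSpan_eq_bot (by omega), finrank_bot]
  · rw [hcard] at hsum
    simp only [hdim]
    rw [hsum]
    have hq := hpow t ht
    have hthick : ∀ A : Finset (E × Fin t),
        rank (fun e => s(a e, b e)) A = rank ends (A.image Prod.fst) := rank_thicken ends
    simp only [hthick]
    rw [Finset.powerset_univ,
      sum_thicken (y - 1) t fun A => (y / (y - 1)) ^ rank ends A, tutte, Finset.mul_sum,
      Finset.powerset_univ, sub_add_cancel]
    refine Finset.sum_congr rfl fun A _ => ?_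
    have hx : (y ^ (t + 1) - 1) / (y ^ (t + 1) - y) - 1 = (y * (y ^ t - 1) / (y - 1))⁻¹ := by
      have : y ^ (t + 1) - y = y * (y ^ t - 1) := by ring
      rw [this]
      field_simp
      ring
    have hr₁ : rank ends A ≤ rank ends Finset.univ := rank_mono ends (Finset.subset_univ A)
    have hr₂ : rank ends A ≤ A.card := rank_le_card _ _ A
    have hR : n - numComponents ends Finset.univ = rank ends Finset.univ := by
      rw [rank, Nat.card_fin]
    have hp0 : y * (y ^ t - 1) / (y - 1) ≠ 0 := div_ne_zero (mul_ne_zero hy hq) hy1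
    rw [hx, hR]
    obtain ⟨i, hi⟩ := Nat.exists_eq_add_of_le hr₁
    obtain ⟨j, hj⟩ := Nat.exists_eq_add_of_le hr₂
    have hP : y * (y ^ t - 1) / (y - 1) = y / (y - 1) * (y ^ t - 1) := mul_div_right_comm _ _ _
    rw [hi, hj, Nat.add_sub_cancel_left, Nat.add_sub_cancel_left]
    generalize y * (y ^ t - 1) / (y - 1) = P at hP hp0 ⊢
    have hPi : P ^ i * P⁻¹ ^ i = 1 := by rw [← mul_pow, mul_inv_cancel₀ hp0, one_pow]
    calc (y ^ t - 1) ^ (rank ends A + j) * (y / (y - 1)) ^ rank ends A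
        = (y / (y - 1) * (y ^ t - 1)) ^ rank ends A * (y ^ t - 1) ^ j := by
          rw [mul_pow, pow_add, mul_comm, mul_assoc]
      _ = P ^ rank ends A * (P ^ i * P⁻¹ ^ i) * (y ^ t - 1) ^ j := by rw [hPi, mul_one, hP]
      _ = P ^ (rank ends A + i) * (P⁻¹ ^ i * (y ^ t - 1) ^ j) := by
          rw [pow_add, mul_assoc, mul_assoc, mul_assoc]

end ForestAlg
end

section
/- Let G be a finite multigraph without loops, t ≥ 1 an integer, and K a field of characteristic 0. Then the largest k for which the k-th graded component of B_G^{F_t} is nonzero is k = t·e(G), and the graded component of degree t·e(G) is one-dimensional over K (it corresponds to the empty forest). -/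
open MvPolynomial

namespace ForestAlg

variable {V E : Type*}

/-- If `D g` is a nonzero constant and `D` is nilpotent on `a`, then `a * g ^ m` has an
antiderivative that is a multiple of `g ^ (m + 1)`. -/
theorem exists_derivation_mul_pow_eq {K R : Type*} [Field K] [CharZero K] [CommRing R]
    [Algebra K R] (D : Derivation K R R) {g : R} {c : K} (hc : c ≠ 0)
    (hg : D g = algebraMap K R c) (N : ℕ) :
    ∀ (a : R) (m : ℕ), (D : R → R)^[N] a = 0 → ∃ b, D (b * g ^ (m + 1)) = a * g ^ m := by
  induction N with
  | zero => exact fun a m ha => ⟨0, by simp_all⟩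
  | succ N ih =>
    intro a m ha
    obtain ⟨b, hb⟩ := ih (D a) (m + 1) (by simpa using ha)
    have hcm : ((m + 1 : ℕ) : K) * c ≠ 0 :=
      mul_ne_zero (Nat.cast_ne_zero.mpr m.succ_ne_zero) hc
    refine ⟨algebraMap K R (((m + 1 : ℕ) : K) * c)⁻¹ * (a - b * g), ?_⟩
    have key : algebraMap K R (((m + 1 : ℕ) : K) * c)⁻¹ * (((m + 1 : ℕ) : R) *
        algebraMap K R c) = 1 := by
      rw [← map_natCast (algebraMap K R), ← map_mul, ← map_mul, inv_mul_cancel₀ hcm, map_one]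
    have h₁ : algebraMap K R (((m + 1 : ℕ) : K) * c)⁻¹ * (a - b * g) * g ^ (m + 1) =
        (((m + 1 : ℕ) : K) * c)⁻¹ • (a * g ^ (m + 1) - b * g ^ (m + 1 + 1)) := by
      rw [Algebra.smul_def]; ring
    rw [h₁, D.map_smul, map_sub, hb, D.leibniz, D.leibniz_pow, hg, Algebra.smul_def]
    simp only [smul_eq_mul, nsmul_eq_mul, add_tsub_cancel_right]
    linear_combination (a * g ^ m) * key

section EdgeList

variable {K : Type*} [Field K]

/-- The derivation `∂ᵢ - ∂ⱼ`. -/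
noncomputable def edgeDeriv (K : Type*) [Field K] (i j : V) :
    Derivation K (MvPolynomial V K) (MvPolynomial V K) :=
  pderiv i - pderiv j

theorem edgeDeriv_apply (i j : V) (p : MvPolynomial V K) :
    edgeDeriv K i j p = pderiv i p - pderiv j p := rfl

theorem edgeDeriv_self (i : V) (p : MvPolynomial V K) : edgeDeriv K i i p = 0 := by
  simp [edgeDeriv_apply]

theorem isHomogeneous_edgeDeriv (i j : V) {p : MvPolynomial V K} {k : ℕ}
    (hp : p.IsHomogeneous k) : (edgeDeriv K i j p).IsHomogeneous (k - 1) :=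
  hp.pderiv.sub hp.pderiv

theorem edgeDeriv_iterate_eq_zero (i j : V) (k : ℕ) :
    ∀ p : MvPolynomial V K, p.IsHomogeneous k → (edgeDeriv K i j)^[k + 1] p = 0 := by
  induction k with
  | zero =>
    intro p hp
    rw [← totalDegree_zero_iff_isHomogeneous, totalDegree_eq_zero_iff_eq_C] at hp
    rw [hp]
    simp
  | succ k ih =>
    intro p hp
    rw [Function.iterate_succ_apply]
    exact ih _ (isHomogeneous_edgeDeriv i j hp)

theorem exists_edgeDeriv_mul_pow_eq [CharZero K] (i j : V) {g : MvPolynomial V K} {c : K}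
    (hc : c ≠ 0) (hg : edgeDeriv K i j g = C c) (a : MvPolynomial V K) (m : ℕ) :
    ∃ b, edgeDeriv K i j (b * g ^ (m + 1)) = a * g ^ m := by
  choose b hb using fun k => exists_derivation_mul_pow_eq (edgeDeriv K i j) hc hg (k + 1)
    (homogeneousComponent k a) m
    (edgeDeriv_iterate_eq_zero i j k _ (homogeneousComponent_isHomogeneous k a))
  refine ⟨∑ k ∈ Finset.range (a.totalDegree + 1), b k, ?_⟩
  rw [Finset.sum_mul, map_sum, Finset.sum_congr rfl fun k _ => hb k, ← Finset.sum_mul,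
    sum_homogeneousComponent]

/-- The composite of the derivations `∂ᵢ - ∂ⱼ` over a list of pairs `(i, j)`. -/
noncomputable def edgeDerivs (K : Type*) [Field K] :
    List (V × V) → MvPolynomial V K →ₗ[K] MvPolynomial V K
  | [] => LinearMap.id
  | e :: L => edgeDerivs K L ∘ₗ (edgeDeriv K e.1 e.2 : _ →ₗ[K] _)

theorem edgeDerivs_cons (e : V × V) (L : List (V × V)) (p : MvPolynomial V K) :
    edgeDerivs K (e :: L) p = edgeDerivs K L (edgeDeriv K e.1 e.2 p) := rfl

theorem isHomogeneous_edgeDerivs (L : List (V × V)) : ∀ {p : MvPolynomial V K} {k : ℕ},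
    p.IsHomogeneous k → (edgeDerivs K L p).IsHomogeneous (k - L.length) := by
  induction L with
  | nil => exact fun hp => hp
  | cons e L ih =>
    intro p k hp
    have := ih (isHomogeneous_edgeDeriv e.1 e.2 hp)
    rwa [Nat.sub_sub, Nat.add_comm] at this

theorem constantCoeff_eq_zero_of_isHomogeneous {p : MvPolynomial V K} {k : ℕ}
    (hp : p.IsHomogeneous k) (hk : k ≠ 0) : constantCoeff p = 0 := by
  rw [constantCoeff_eq]
  exact hp.coeff_eq_zero (by simpa using hk.symm)

theorem constantCoeff_edgeDerivs_eq_zero {L : List (V × V)} {p : MvPolynomial V K} {k : ℕ}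
    (hp : p.IsHomogeneous k) (hk : L.length < k) : constantCoeff (edgeDerivs K L p) = 0 :=
  constantCoeff_eq_zero_of_isHomogeneous (isHomogeneous_edgeDerivs L hp) (by omega)

theorem edgeDerivs_linear_pow_ne_zero [CharZero K] {ℓ : MvPolynomial V K} {a : V → K}
    (ha : Function.Injective a) (hℓ : ∀ i j, edgeDeriv K i j ℓ = C (a i - a j))
    (L : List (V × V)) (hL : ∀ e ∈ L, e.1 ≠ e.2) :
    ∃ c : K, c ≠ 0 ∧ edgeDerivs K L (ℓ ^ L.length) = C c := by
  induction L with
  | nil => exact ⟨1, one_ne_zero, by simp [edgeDerivs]⟩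
  | cons e L ih =>
    obtain ⟨c, hc, h⟩ := ih fun f hf => hL f (List.mem_cons_of_mem _ hf)
    have hd : a e.1 - a e.2 ≠ 0 :=
      sub_ne_zero.mpr fun h => hL e List.mem_cons_self (ha h)
    refine ⟨((L.length + 1 : ℕ) : K) * (a e.1 - a e.2) * c,
      mul_ne_zero (mul_ne_zero (Nat.cast_ne_zero.mpr (Nat.succ_ne_zero _)) hd) hc, ?_⟩
    have h₁ : edgeDeriv K e.1 e.2 (ℓ ^ (L.length + 1)) =
        (((L.length + 1 : ℕ) : K) * (a e.1 - a e.2)) • ℓ ^ L.length := by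
      rw [Derivation.leibniz_pow, hℓ, smul_eq_C_mul, map_mul, map_natCast]
      simp only [smul_eq_mul, nsmul_eq_mul, add_tsub_cancel_right]
      ring
    rw [edgeDerivs_cons, List.length_cons, h₁, map_smul, h, smul_eq_C_mul, ← map_mul]

theorem isHomogeneous_sum_X (I : Finset V) :
    (∑ i ∈ I, X i : MvPolynomial V K).IsHomogeneous 1 :=
  IsHomogeneous.sum _ _ _ fun i _ => isHomogeneous_X K i

variable [DecidableEq V]

/-- The number of pairs in `L` separated by `I`. -/
def cutCount (L : List (V × V)) (I : Finset V) : ℕ :=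
  L.countP fun e => ¬(e.1 ∈ I ↔ e.2 ∈ I)

theorem cutCount_cons (e : V × V) (L : List (V × V)) (I : Finset V) :
    cutCount (e :: L) I = cutCount L I + if (e.1 ∈ I ↔ e.2 ∈ I) then 0 else 1 := by
  by_cases h : (e.1 ∈ I ↔ e.2 ∈ I) <;> simp [cutCount, h]

/-- The ideal generated by the powers `(∑_{i ∈ I} x_i) ^ (cutCount L I + 1)`. -/
noncomputable def cutIdeal (K : Type*) [Field K] (L : List (V × V)) :
    Ideal (MvPolynomial V K) :=
  Ideal.span {p | ∃ I : Finset V, p = (∑ i ∈ I, X i) ^ (cutCount L I + 1)}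

theorem pow_mem_cutIdeal (L : List (V × V)) (I : Finset V) :
    (∑ i ∈ I, X i) ^ (cutCount L I + 1) ∈ cutIdeal K L :=
  Ideal.subset_span ⟨I, rfl⟩

theorem edgeDeriv_sum_X (i j : V) (I : Finset V) :
    edgeDeriv K i j (∑ a ∈ I, X a) =
      C ((if i ∈ I then 1 else 0) - if j ∈ I then 1 else 0) := by
  simp [edgeDeriv_apply, pderiv_X, apply_ite C]

theorem homogeneousComponent_mem_cutIdeal {L : List (V × V)} {p : MvPolynomial V K}
    (hp : p ∈ cutIdeal K L) (k : ℕ) : homogeneousComponent k p ∈ cutIdeal K L := by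
  let := gradedAlgebra (σ := V) (R := K)
  refine homogeneousComponent_mem_of_mem (Ideal.homogeneous_span _ _ ?_) hp k
  rintro _ ⟨I, rfl⟩
  exact ⟨_, (isHomogeneous_sum_X I).pow _⟩

theorem edgeDerivs_mul_pow_mem (I : Finset V) (L : List (V × V)) :
    ∀ (b : MvPolynomial V K) (m : ℕ),
      edgeDerivs K L (b * (∑ i ∈ I, X i) ^ (cutCount L I + m)) ∈
        Ideal.span {(∑ i ∈ I, X i : MvPolynomial V K) ^ m} := by
  induction L with
  | nil =>
    intro b m
    rw [Ideal.mem_span_singleton]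
    exact ⟨b, by simp [edgeDerivs, cutCount, mul_comm]⟩
  | cons e L ih =>
    intro b m
    rw [edgeDerivs_cons, cutCount_cons, Derivation.leibniz, Derivation.leibniz_pow,
      edgeDeriv_sum_X]
    set g : MvPolynomial V K := ∑ i ∈ I, X i
    by_cases h : (e.1 ∈ I ↔ e.2 ∈ I)
    · have := ih (edgeDeriv K e.1 e.2 b) m
      simpa [h, mul_comm] using this
    · set c : MvPolynomial V K := C ((if e.1 ∈ I then 1 else 0) - if e.2 ∈ I then 1 else 0)
      convert! ih (b * (cutCount L I + 1 + m : ℕ) * c + edgeDeriv K e.1 e.2 b * g) m using 2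
      have h₁ : cutCount L I + 1 + m - 1 = cutCount L I + m := by omega
      simp only [h, if_false, smul_eq_mul, nsmul_eq_mul, h₁]
      ring

theorem constantCoeff_edgeDerivs_of_mem {L : List (V × V)} {p : MvPolynomial V K}
    (hp : p ∈ cutIdeal K L) : constantCoeff (edgeDerivs K L p) = 0 := by
  suffices ∀ b, constantCoeff (edgeDerivs K L (b * p)) = 0 by simpa using this 1
  induction hp using Submodule.span_induction with
  | mem x hx =>
    obtain ⟨I, rfl⟩ := hx
    intro b
    obtain ⟨q, hq⟩ := Ideal.mem_span_singleton.mp (edgeDerivs_mul_pow_mem I L b 1)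
    rw [hq, map_mul]
    simp
  | zero => simp
  | add x y _ _ hx hy => intro b; rw [mul_add, map_add, map_add, hx, hy, add_zero]
  | smul a x _ hx => intro b; rw [smul_eq_mul, ← mul_assoc]; exact hx _

theorem exists_edgeDeriv_eq_of_mem [CharZero K] {i j : V} (hij : i ≠ j) {L : List (V × V)}
    {q : MvPolynomial V K} (hq : q ∈ cutIdeal K L) :
    ∃ p ∈ cutIdeal K ((i, j) :: L), edgeDeriv K i j p = q := by
  suffices ∀ a, ∃ p ∈ cutIdeal K ((i, j) :: L), edgeDeriv K i j p = a * q by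
    simpa using this 1
  induction hq using Submodule.span_induction with
  | mem x hx =>
    obtain ⟨I, rfl⟩ := hx
    intro a
    have hmem := pow_mem_cutIdeal (K := K) ((i, j) :: L) I
    have hder := edgeDeriv_sum_X (K := K) i j I
    rw [cutCount_cons] at hmem
    by_cases h : (i ∈ I ↔ j ∈ I)
    · obtain ⟨b, hb⟩ := exists_edgeDeriv_mul_pow_eq i j (g := X i) (c := (1 : K)) one_ne_zero
        (by simp [edgeDeriv_apply, pderiv_X, hij]) a 0
      refine ⟨b * X i ^ (0 + 1) * (∑ i ∈ I, X i) ^ (cutCount L I + 1),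
        Ideal.mul_mem_left _ _ (by simpa [h] using hmem), ?_⟩
      rw [Derivation.leibniz, Derivation.leibniz_pow, hder, hb]
      simp [h, mul_comm]
    · obtain ⟨b, hb⟩ := exists_edgeDeriv_mul_pow_eq i j (g := ∑ i ∈ I, X i) (by
        by_cases hi : i ∈ I <;> by_cases hj : j ∈ I <;> simp_all) hder a (cutCount L I + 1)
      exact ⟨_, Ideal.mul_mem_left _ b (by simpa [h] using hmem), hb⟩
  | zero => exact fun a => ⟨0, zero_mem _, by simp⟩
  | add x y _ _ hx hy =>
    intro a
    obtain ⟨p, hp, hpx⟩ := hx a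
    obtain ⟨q, hq, hqy⟩ := hy a
    exact ⟨p + q, add_mem hp hq, by rw [map_add, hpx, hqy, mul_add]⟩
  | smul b x _ hx =>
    intro a
    obtain ⟨p, hp, hpx⟩ := hx (a * b)
    exact ⟨p, hp, by rw [hpx, smul_eq_mul, mul_assoc]⟩

theorem aeval_update_eq_self_of_pderiv_eq_zero [CharZero K] {j : V} {p : MvPolynomial V K}
    (hp : pderiv j p = 0) : aeval (Function.update X j 0) p = p := by
  have hj : j ∉ p.vars := by
    rw [mem_vars_iff_mem_support]
    rintro ⟨d, hd, hjd⟩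
    have h := coeff_pderiv (i := j) p (d - Finsupp.single j 1)
    have hd' : d - Finsupp.single j 1 + Finsupp.single j 1 = d := by
      refine tsub_add_cancel_of_le ?_
      simpa [Nat.one_le_iff_ne_zero] using hjd
    rw [hp, hd', coeff_zero, eq_comm, mul_eq_zero] at h
    rcases h with h | h
    · exact mem_support_iff.mp hd h
    · exact Nat.cast_add_one_ne_zero _ h
  have h := hom_congr_vars (f₁ := (aeval (Function.update X j 0 : V → MvPolynomial V K) :
    MvPolynomial V K →ₐ[K] _).toRingHom) (f₂ := RingHom.id _) (p₁ := p) (p₂ := p)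
    (by ext; simp) (fun a ha _ => by
      have : a ≠ j := fun h => hj (h ▸ ha)
      simp [this]) rfl
  exact h

variable [Fintype V]

/-- The algebra map sending `x_b` to the sum of the variables over the fiber of `f` at `b`. -/
noncomputable def fiberSum (K : Type*) [Field K] (f : V → V) :
    MvPolynomial V K →ₐ[K] MvPolynomial V K :=
  aeval fun b => ∑ a with f a = b, X a

theorem fiberSum_mem_cutIdeal (f : V → V) {L : List (V × V)} {p : MvPolynomial V K}
    (hp : p ∈ cutIdeal K (L.map (Prod.map f f))) : fiberSum K f p ∈ cutIdeal K L := by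
  suffices cutIdeal K (L.map (Prod.map f f)) ≤ (cutIdeal K L).comap (fiberSum K f) from this hp
  refine Ideal.span_le.mpr ?_
  rintro _ ⟨I, rfl⟩
  have h := pow_mem_cutIdeal (K := K) L {a | f a ∈ I}
  have hc : cutCount (L.map (Prod.map f f)) I = cutCount L {a | f a ∈ I} := by
    simp [cutCount, List.countP_map, Function.comp_def]
  have hs : fiberSum K f (∑ i ∈ I, X i) = ∑ a with f a ∈ I, X a := by
    rw [map_sum, ← Finset.sum_fiberwise_of_maps_to (s := {a | f a ∈ I}) (t := I) (g := f)
      fun a ha => (Finset.mem_filter.mp ha).2]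
    refine Finset.sum_congr rfl fun b hb => ?_
    rw [fiberSum, aeval_X]
    refine Finset.sum_congr ?_ fun _ _ => rfl
    ext a
    simp only [Finset.mem_filter, Finset.mem_univ, true_and]
    exact ⟨fun h => ⟨h ▸ hb, h⟩, fun h => h.2⟩
  rw [SetLike.mem_coe, Ideal.mem_comap, map_pow, hc, hs]
  exact h

theorem fiberSum_eq_self_of_edgeDeriv_eq_zero [CharZero K] {i j : V} (hij : i ≠ j)
    {p : MvPolynomial V K} (hp : edgeDeriv K i j p = 0) :
    fiberSum K (fun a => if a = j then i else a) p = p := by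
  let φ : MvPolynomial V K →ₐ[K] MvPolynomial V K := aeval (Function.update X i (X i - X j))
  let ψ : MvPolynomial V K →ₐ[K] MvPolynomial V K := aeval (Function.update X i (X i + X j))
  have chain : ∀ q, pderiv j (φ q) = φ (pderiv j q - pderiv i q) := by
    intro q
    induction q using MvPolynomial.induction_on with
    | C a => simp [φ]
    | add q r hq hr => simp only [map_add, hq, hr, map_sub]; ring
    | mul_X q a hq =>
      have hX : pderiv j (φ (X a)) = φ (pderiv j (X a) - pderiv i (X a)) := by
        by_cases hi : a = i
        · subst hi; simp [φ, pderiv_X, hij]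
        · by_cases hj : a = j
          · subst hj; simp [φ, pderiv_X, hi]
          · simp [φ, pderiv_X, hi, hj]
      rw [map_mul, Derivation.leibniz, hX, hq, Derivation.leibniz, Derivation.leibniz]
      simp only [smul_eq_mul, map_sub, map_add, map_mul]
      ring
  have h₀ : pderiv j (φ p) = 0 := by
    rw [chain, ← neg_sub, ← edgeDeriv_apply, hp, neg_zero, map_zero]
  have h₁ := congrArg ψ (aeval_update_eq_self_of_pderiv_eq_zero h₀)
  have hψφ : ψ.comp φ = AlgHom.id K _ := by
    ext1 a
    by_cases hi : a = i
    · subst hi; simp [φ, ψ, hij.symm]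
    · simp [φ, ψ, hi]
  have hcomp : (ψ.comp (aeval (Function.update X j 0))).comp φ =
      fiberSum K (fun a => if a = j then i else a) := by
    ext1 a
    have hfib : fiberSum K (fun a => if a = j then i else a) (X a) =
        if a = i then X i + X j else if a = j then 0 else X a := by
      rw [fiberSum, aeval_X]
      by_cases hi : a = i
      · subst hi
        have : ({b | (if b = j then a else b) = a} : Finset V) = {a, j} := by
          ext b; by_cases hb : b = j <;> simp [hb]
        rw [this, Finset.sum_pair hij, if_pos rfl]
      · by_cases hj : a = j
        · subst hj
          have : ({b | (if b = a then i else b) = a} : Finset V) = ∅ := by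
            ext b; by_cases hb : b = a <;> simp [hb, hij]
          rw [this, if_neg hi, if_pos rfl, Finset.sum_empty]
        · have : ({b | (if b = j then i else b) = a} : Finset V) = {a} := by
            ext b
            by_cases hb : b = j
            · subst hb; simp [Ne.symm hi, Ne.symm hj]
            · simp [hb]
          rw [this, if_neg hi, if_neg hj, Finset.sum_singleton]
    rw [hfib]
    by_cases hi : a = i
    · subst hi; simp [φ, ψ, hij]
    · by_cases hj : a = j
      · subst hj; simp [φ, ψ, hi]
      · simp [φ, ψ, hi, hj]
  have h₂ := DFunLike.congr_fun hcomp p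
  have h₃ := DFunLike.congr_fun hψφ p
  simp only [AlgHom.comp_apply, AlgHom.id_apply] at h₂ h₃
  rw [← h₂, h₁, h₃]

theorem mem_cutIdeal_of_constantCoeff_edgeDerivs_eq_zero [CharZero K] (N : ℕ) :
    ∀ (L : List (V × V)), L.length = N → ∀ (p : MvPolynomial V K) (k : ℕ), p.IsHomogeneous k →
      N ≤ k → constantCoeff (edgeDerivs K L p) = 0 → p ∈ cutIdeal K L := by
  induction N with
  | zero =>
    intro L hL p k _ _ hp
    obtain rfl := List.length_eq_zero_iff.mp hL
    have hX : Ideal.span (X '' Set.univ) ≤ cutIdeal K ([] : List (V × V)) := by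
      refine Ideal.span_le.mpr ?_
      rintro _ ⟨i, -, rfl⟩
      simpa [cutCount] using pow_mem_cutIdeal (K := K) [] {i}
    refine hX (mem_ideal_span_X_image.mpr fun m hm => ?_)
    by_contra! h
    have hm0 : m = 0 := Finsupp.ext fun i => h i (Set.mem_univ i)
    exact mem_support_iff.mp hm (hm0 ▸ hp)
  | succ N ih =>
    rintro (_ | ⟨⟨i, j⟩, L⟩) hL p k hp hk hc
    · simp at hL
    have hL' : L.length = N := by simpa using hL
    by_cases hij : i = j
    · subst hij
      have h := ih L hL' p k hp (by omega) (constantCoeff_edgeDerivs_eq_zero hp (by omega))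
      have : cutIdeal K ((i, i) :: L) = cutIdeal K L := by simp [cutIdeal, cutCount_cons]
      rwa [this]
    have hmem := ih L hL' (edgeDeriv K i j p) (k - 1) (isHomogeneous_edgeDeriv i j hp)
      (by omega) hc
    obtain ⟨q, hq, hqp⟩ := exists_edgeDeriv_eq_of_mem hij hmem
    let f : V → V := fun a => if a = j then i else a
    have hfix : fiberSum K f (p - q) = p - q :=
      fiberSum_eq_self_of_edgeDeriv_eq_zero hij (by rw [map_sub, hqp, sub_self])
    have hhom : ∀ (n : ℕ) (r : MvPolynomial V K), r.IsHomogeneous n →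
        (fiberSum K f r).IsHomogeneous n := by
      intro n r hr
      have := hr.aeval (fun b => ∑ a with f a = b, X a : V → MvPolynomial V K)
        (fun b => isHomogeneous_sum_X _)
      rwa [one_mul] at this
    have hcomp : ∀ r : MvPolynomial V K, homogeneousComponent k (fiberSum K f r) =
        fiberSum K f (homogeneousComponent k r) := by
      intro r
      conv_lhs => rw [← sum_homogeneousComponent r]
      simp only [map_sum]
      rw [Finset.sum_congr rfl fun n _ => homogeneousComponent_of_mem
        ((mem_homogeneousSubmodule _ _).mpr (hhom n _ (homogeneousComponent_isHomogeneous n r)))]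
      rw [Finset.sum_ite_eq]
      split_ifs with h
      · rfl
      · rw [homogeneousComponent_eq_zero, map_zero]
        simpa using h
    set r := homogeneousComponent k (p - q) with hr
    have hrk : r.IsHomogeneous k := homogeneousComponent_isHomogeneous k _
    have hrfix : fiberSum K f r = r := by rw [hr, ← hcomp, hfix]
    have hrmem : r ∈ cutIdeal K ((i, j) :: L) := by
      have h := ih (L.map (Prod.map f f)) (by simpa using hL') r k hrk (by omega)
        (constantCoeff_edgeDerivs_eq_zero hrk (by simp; omega))
      rw [← hrfix]
      refine fiberSum_mem_cutIdeal f ?_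
      have hff : cutIdeal K (((i, j) :: L).map (Prod.map f f)) =
          cutIdeal K (L.map (Prod.map f f)) := by
        simp [cutIdeal, cutCount_cons, f]
      rwa [hff]
    have hpr : p = r + homogeneousComponent k q := by
      rw [hr, map_sub, homogeneousComponent_eq_self hp, sub_add_cancel]
    rw [hpr]
    exact add_mem hrmem (homogeneousComponent_mem_cutIdeal hq k)

end EdgeList

theorem exists_edgeList {n : ℕ} {E : Type*} [Fintype E] (ends : E → Sym2 (Fin n))
    (hloopless : ∀ e : E, ¬ (ends e).IsDiag) (t : ℕ) :
    ∃ L : List (Fin n × Fin n), (∀ e ∈ L, e.1 ≠ e.2) ∧ L.length = t * Fintype.card E ∧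
      ∀ I, cutCount L I = t * crossCount ends I := by
  classical
  have hs : ∀ e, ∃ a : Fin n × Fin n, ends e = s(a.1, a.2) := fun e => by
    induction h : ends e with | _ a b => exact ⟨(a, b), rfl⟩
  choose s hs using hs
  refine ⟨(Finset.univ : Finset E).toList.flatMap fun e => List.replicate t (s e), ?_, ?_, ?_⟩
  · simp only [List.mem_flatMap, List.mem_replicate]
    rintro _ ⟨e, -, -, rfl⟩ h
    exact hloopless e (by rw [hs, Sym2.mk_isDiag_iff]; exact h)
  · simp [List.length_flatMap, mul_comm]
  · intro I
    have hset : {e : E | (∃ v ∈ ends e, v ∈ I) ∧ ∃ w ∈ ends e, w ∉ I} =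
        ((Finset.univ.filter fun e : E => ¬((s e).1 ∈ I ↔ (s e).2 ∈ I) : Finset E) : Set E) := by
      ext e
      simp only [hs, Sym2.mem_iff, Set.mem_ofPred_eq, Finset.coe_filter, Finset.mem_univ,
        true_and, exists_eq_or_imp, exists_eq_left]
      tauto
    rw [crossCount, hset, Set.ncard_coe_finset, cutCount, List.countP_flatMap,
      Finset.card_filter, Finset.mul_sum, ← Finset.sum_map_toList]
    congr 1
    refine List.map_congr_left fun e _ => ?_
    simp only [Function.comp_apply, List.countP_replicate]
    by_cases h : ((s e).1 ∈ I ↔ (s e).2 ∈ I) <;> simp [h]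

theorem forestIdeal_eq_cutIdeal {K : Type*} [Field K] {n t : ℕ} {ends : E → Sym2 (Fin n)}
    {L : List (Fin n × Fin n)} (hL : ∀ I, cutCount L I = t * crossCount ends I) :
    forestIdeal K t ends = cutIdeal K L := by
  refine le_antisymm (Ideal.span_mono ?_) (Ideal.span_le.mpr ?_)
  · rintro _ ⟨I, -, rfl⟩
    exact ⟨I, by rw [hL]⟩
  · rintro _ ⟨I, rfl⟩
    obtain rfl | hI := I.eq_empty_or_nonempty
    · simp
    · exact Ideal.subset_span ⟨I, hI, by rw [hL]⟩

/-- Let `G` be a finite multigraph without loops on vertices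
`1,…,n`, `t ≥ 1`, and `K` a field of characteristic `0`. Then the largest `k`
for which the `k`-th graded component of `B_G^{F_t}` is nonzero is
`k = t·e(G)`: all components of degree `> t·e(G)` vanish, and the component of
degree `t·e(G)` is one-dimensional over `K`. -/
theorem top_gradedPiece_B_Ft {n : ℕ} {E : Type} [Fintype E]
    (ends : E → Sym2 (Fin n)) (hloopless : ∀ e : E, ¬ (ends e).IsDiag)
    (t : ℕ) (ht : 1 ≤ t) (K : Type) [Field K] [CharZero K] :
    gradedDim K (forestIdeal K t ends) (t * Fintype.card E) = 1 ∧
    ∀ k : ℕ, t * Fintype.card E < k →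
      gradedPiece K (forestIdeal K t ends) k = ⊥ := by
  obtain ⟨L, hne, hlen, hcut⟩ := exists_edgeList ends hloopless t
  rw [forestIdeal_eq_cutIdeal hcut, ← hlen]
  have hmem := mem_cutIdeal_of_constantCoeff_edgeDerivs_eq_zero (K := K) L.length L rfl
  constructor
  · set ℓ : MvPolynomial (Fin n) K := ∑ i : Fin n, C ((i : ℕ) : K) * X i with hℓ
    have hder : ∀ i j : Fin n, edgeDeriv K i j ℓ = C (((i : ℕ) : K) - ((j : ℕ) : K)) := by
      intro i j
      simp [hℓ, edgeDeriv_apply, pderiv_X, Pi.single_apply, mul_sub,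
        Finset.sum_sub_distrib]
    obtain ⟨c, hc, hcL⟩ := edgeDerivs_linear_pow_ne_zero
      (fun i j h => Fin.ext (Nat.cast_injective h)) hder L hne
    have hhom : (ℓ ^ L.length).IsHomogeneous L.length := by
      have h₁ : ℓ.IsHomogeneous 1 := IsHomogeneous.sum _ _ _ fun i _ => 
        (isHomogeneous_X K i).C_mul _
      simpa using h₁.pow L.length
    have hnot : ℓ ^ L.length ∉ cutIdeal K L := fun h => hc (by
      simpa [hcL] using constantCoeff_edgeDerivs_of_mem h)
    refine (finrank_eq_one_iff_of_nonzero' (⟨Ideal.Quotient.mk _ (ℓ ^ L.length),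
      ⟨_, hhom, rfl⟩⟩ : gradedPiece K (cutIdeal K L) L.length) ?_).mpr ?_
    · intro h
      exact hnot (Ideal.Quotient.eq_zero_iff_mem.mp (congrArg Subtype.val h))
    · rintro ⟨_, p, hp, rfl⟩
      let d := constantCoeff (edgeDerivs K L p) / c
      have hsub : d • ℓ ^ L.length - p ∈ cutIdeal K L := by
        refine hmem _ _ (((homogeneousSubmodule _ _ _).smul_mem d hhom).sub hp) le_rfl ?_
        rw [map_sub, map_smul, hcL, map_sub, smul_eq_C_mul, ← map_mul, constantCoeff_C,
          div_mul_cancel₀ _ hc, sub_self]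
      refine ⟨d, Subtype.ext ?_⟩
      exact Ideal.Quotient.eq.mpr hsub
  · intro k hk
    rw [eq_bot_iff]
    rintro _ ⟨p, hp, rfl⟩
    exact Ideal.Quotient.eq_zero_iff_mem.mpr
      (hmem p k hp hk.le (constantCoeff_edgeDerivs_eq_zero hp hk))

end ForestAlg
end
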